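/- Reduction for A_{2n−1}^(2) (Remark at the end of Section 5): Let n ≥ 2 and l, k ≥ 2. For b = (x_1,…,x̄_1) ∈ B_{l−1}, define ά^l_{l−1}(b) = (x_1+1, x_2, …, x̄_1) ∈ B_l and ὰ^l_{l−1}(b) = (x_1, …, x̄_2, x̄_1+1) ∈ B_l. Let ι : B_l ⊗ B_k → B_k ⊗ B_l and ι' : B_{l−1} ⊗ B_{k−1} → B_{k−1} ⊗ B_{l−1} be isomorphisms of U_q'(A_{2n−1}^(2)) crystals, with energy functions H and H' respectively. Then for all c_1 ∈ B_{l−1} and c_2 ∈ B_{k−1}, writing ι'(c_1 ⊗ c_2) = c'_2 ⊗ c'_1, one has ι(ά^l_{l−1}(c_1) ⊗ ὰ^k_{k−1}(c_2)) = ά^k_{k−1}(c'_2) ⊗ ὰ^l_{l−1}(c'_1), and H(ά^l_{l−1}(c_1) ⊗ ὰ^k_{k−1}(c_2)) = H'(c_1 ⊗ c_2). -/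

import Mathlib

namespace KTT

/-- Raw data of a crystal element `(x_1,…,x_n,x̄_n,…,x̄_1)`:
`b.1 i` is `x_{i+1}` and `b.2 i` is `x̄_{i+1}` for `i : Fin n`. -/
abbrev Tup (n : ℕ) := (Fin n → ℕ) × (Fin n → ℕ)

/-- The entry `x_j` (for `1 ≤ j ≤ n`). -/
def xc {n : ℕ} (b : Tup n) (j : ℕ) : ℕ :=
  if h : j - 1 < n then b.1 ⟨j - 1, h⟩ else 0

/-- The entry `x̄_j` (for `1 ≤ j ≤ n`). -/
def xbc {n : ℕ} (b : Tup n) (j : ℕ) : ℕ :=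
  if h : j - 1 < n then b.2 ⟨j - 1, h⟩ else 0

/-- Set the entry indexed by `j` (i.e. `x_j`) to the value `v`. -/
def setx {n : ℕ} (f : Fin n → ℕ) (j v : ℕ) : Fin n → ℕ :=
  fun t => if (t : ℕ) + 1 = j then v else f t

/-- `Σ_{i=1}^n (x_i + x̄_i)`. -/
def tsum {n : ℕ} (b : Tup n) : ℕ := ∑ i, (b.1 i + b.2 i)

/-- The element `(v,0,…,0)`. -/
def uvec (n v : ℕ) : Tup n := (fun j => if (j : ℕ) = 0 then v else 0, fun _ => 0)

/-- The element `(0,v,---,0)` (only `x_2 = v` nonzero). -/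
def u2vec (n v : ℕ) : Tup n := (fun j => if (j : ℕ) = 1 then v else 0, fun _ => 0)

/-- The element `(0,0,---,v)` (only `x̄_1 = v` nonzero). -/
def barvec (n v : ℕ) : Tup n := (fun _ => 0, fun j => if (j : ℕ) = 0 then v else 0)

/-- The element `(a,c,---,d)` with `x_1 = a`, `x_2 = c`, `x̄_1 = d`, all else `0`. -/
def tripleVec (n a c d : ℕ) : Tup n :=
  (fun j => if (j : ℕ) = 0 then a else if (j : ℕ) = 1 then c else 0,
   fun j => if (j : ℕ) = 0 then d else 0)

/-! ### The `U_q'(C_n^{(1)})` crystal `B_l` -/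

/-- Membership in the `C_n^{(1)}` crystal `B_l` : the sum of the entries belongs to
`{l, l-2, l-4, …}`. -/
def memC (n l : ℕ) (b : Tup n) : Prop := tsum b ≤ l ∧ (l - tsum b) % 2 = 0

def BC (n l : ℕ) : Set (Tup n) := {b | memC n l b}

/-- The number `x_0(b)` of `(0,0̄)` pairs. -/
def x0 (l : ℕ) {n : ℕ} (b : Tup n) : ℕ := (l - tsum b) / 2

/-- The operator `ẽ_i` on `B_l` (C case); `none` plays the role of `0`. -/
def eC (n l i : ℕ) (b : Tup n) : Option (Tup n) :=
  if i = 0 then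
    if 0 < n then
      if xbc b 1 + 2 ≤ xc b 1 then some (setx b.1 1 (xc b 1 - 2), b.2)
      else if xc b 1 = xbc b 1 + 1 then
        some (setx b.1 1 (xc b 1 - 1), setx b.2 1 (xbc b 1 + 1))
      else if tsum b + 2 ≤ l then some (b.1, setx b.2 1 (xbc b 1 + 2))
      else none
    else none
  else if i = n then
    if 0 < xbc b n then some (setx b.1 n (xc b n + 1), setx b.2 n (xbc b n - 1))
    else none
  else if i < n then
    if xbc b (i + 1) < xc b (i + 1) then
      some (setx (setx b.1 i (xc b i + 1)) (i + 1) (xc b (i + 1) - 1), b.2)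
    else if 0 < xbc b i then
      some (b.1, setx (setx b.2 (i + 1) (xbc b (i + 1) + 1)) i (xbc b i - 1))
    else none
  else none

/-- The operator `f̃_i` on `B_l` (C case). -/
def fC (n l i : ℕ) (b : Tup n) : Option (Tup n) :=
  if i = 0 then
    if 0 < n then
      if xbc b 1 ≤ xc b 1 then
        if tsum b + 2 ≤ l then some (setx b.1 1 (xc b 1 + 2), b.2) else none
      else if xc b 1 + 1 = xbc b 1 then
        some (setx b.1 1 (xc b 1 + 1), setx b.2 1 (xbc b 1 - 1))
      else some (b.1, setx b.2 1 (xbc b 1 - 2))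
    else none
  else if i = n then
    if 0 < xc b n then some (setx b.1 n (xc b n - 1), setx b.2 n (xbc b n + 1))
    else none
  else if i < n then
    if xbc b (i + 1) ≤ xc b (i + 1) then
      if 0 < xc b i then
        some (setx (setx b.1 i (xc b i - 1)) (i + 1) (xc b (i + 1) + 1), b.2)
      else none
    else some (b.1, setx (setx b.2 (i + 1) (xbc b (i + 1) - 1)) i (xbc b i + 1))
  else none

def eCIter (n l i m : ℕ) (b : Tup n) : Option (Tup n) :=
  (fun o => Option.bind o (eC n l i))^[m] (some b)

def fCIter (n l i m : ℕ) (b : Tup n) : Option (Tup n) :=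
  (fun o => Option.bind o (fC n l i))^[m] (some b)

/-- `ε_i(b) = max {m | ẽ_i^m b ≠ 0}` (C case). -/
noncomputable def epsC (n l i : ℕ) (b : Tup n) : ℕ :=
  sSup {m | eCIter n l i m b ≠ none}

/-- `φ_i(b) = max {m | f̃_i^m b ≠ 0}` (C case). -/
noncomputable def phiC (n l i : ℕ) (b : Tup n) : ℕ :=
  sSup {m | fCIter n l i m b ≠ none}

/-- `ẽ_i` on the tensor product `B_l ⊗ B_k` (C case). -/
noncomputable def eTenC (n l k i : ℕ) (u : Tup n × Tup n) : Option (Tup n × Tup n) :=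
  if epsC n k i u.2 ≤ phiC n l i u.1 then (eC n l i u.1).map (fun c => (c, u.2))
  else (eC n k i u.2).map (fun c => (u.1, c))

/-- `f̃_i` on the tensor product `B_l ⊗ B_k` (C case). -/
noncomputable def fTenC (n l k i : ℕ) (u : Tup n × Tup n) : Option (Tup n × Tup n) :=
  if epsC n k i u.2 < phiC n l i u.1 then (fC n l i u.1).map (fun c => (c, u.2))
  else (fC n k i u.2).map (fun c => (u.1, c))

/-- `ι : B_l ⊗ B_k → B_k ⊗ B_l` is an isomorphism of `U_q'(C_n^{(1)})` crystals. -/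
def IsIsoC (n l k : ℕ) (ι : Tup n × Tup n → Tup n × Tup n) : Prop :=
  Set.BijOn ι (BC n l ×ˢ BC n k) (BC n k ×ˢ BC n l) ∧
  ∀ u ∈ BC n l ×ˢ BC n k, ∀ i ≤ n,
    Option.map ι (eTenC n l k i u) = eTenC n k l i (ι u) ∧
    Option.map ι (fTenC n l k i u) = fTenC n k l i (ι u)

/-- `H` is an energy function for the isomorphism `ι` (C case), normalized by
`H((l,0,…,0) ⊗ (0,k,---,0)) = 0`. -/
def IsEnergyC (n l k : ℕ) (ι : Tup n × Tup n → Tup n × Tup n)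
    (H : Tup n × Tup n → ℤ) : Prop :=
  (∀ u ∈ BC n l ×ˢ BC n k, ∀ i ≤ n, ∀ v, eTenC n l k i u = some v →
      H v = H u +
        (if i = 0 then
          (if epsC n k 0 u.2 ≤ phiC n l 0 u.1 ∧ epsC n l 0 (ι u).2 ≤ phiC n k 0 (ι u).1
           then 1
           else if phiC n l 0 u.1 < epsC n k 0 u.2 ∧ phiC n k 0 (ι u).1 < epsC n l 0 (ι u).2
           then -1 else 0)
         else 0)) ∧
  H (uvec n l, u2vec n k) = 0

/-! ### The `U_q'(A_{2n-1}^{(2)})` crystal `B_l` -/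

def memA (n l : ℕ) (b : Tup n) : Prop := tsum b = l

def BA (n l : ℕ) : Set (Tup n) := {b | memA n l b}

/-- The operator `ẽ_i` (A case). -/
def eA (n i : ℕ) (b : Tup n) : Option (Tup n) :=
  if i = 0 then
    if 1 < n then
      if xbc b 2 < xc b 2 then some (setx b.1 2 (xc b 2 - 1), setx b.2 1 (xbc b 1 + 1))
      else if 0 < xc b 1 then some (setx b.1 1 (xc b 1 - 1), setx b.2 2 (xbc b 2 + 1))
      else none
    else none
  else if i = n then
    if 0 < xbc b n then some (setx b.1 n (xc b n + 1), setx b.2 n (xbc b n - 1))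
    else none
  else if i < n then
    if xbc b (i + 1) < xc b (i + 1) then
      some (setx (setx b.1 i (xc b i + 1)) (i + 1) (xc b (i + 1) - 1), b.2)
    else if 0 < xbc b i then
      some (b.1, setx (setx b.2 (i + 1) (xbc b (i + 1) + 1)) i (xbc b i - 1))
    else none
  else none

/-- The operator `f̃_i` (A case). -/
def fA (n i : ℕ) (b : Tup n) : Option (Tup n) :=
  if i = 0 then
    if 1 < n then
      if xbc b 2 ≤ xc b 2 then
        if 0 < xbc b 1 then some (setx b.1 2 (xc b 2 + 1), setx b.2 1 (xbc b 1 - 1))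
        else none
      else some (setx b.1 1 (xc b 1 + 1), setx b.2 2 (xbc b 2 - 1))
    else none
  else if i = n then
    if 0 < xc b n then some (setx b.1 n (xc b n - 1), setx b.2 n (xbc b n + 1))
    else none
  else if i < n then
    if xbc b (i + 1) ≤ xc b (i + 1) then
      if 0 < xc b i then
        some (setx (setx b.1 i (xc b i - 1)) (i + 1) (xc b (i + 1) + 1), b.2)
      else none
    else some (b.1, setx (setx b.2 (i + 1) (xbc b (i + 1) - 1)) i (xbc b i + 1))
  else none

def eAIter (n i m : ℕ) (b : Tup n) : Option (Tup n) :=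
  (fun o => Option.bind o (eA n i))^[m] (some b)

def fAIter (n i m : ℕ) (b : Tup n) : Option (Tup n) :=
  (fun o => Option.bind o (fA n i))^[m] (some b)

noncomputable def epsA (n i : ℕ) (b : Tup n) : ℕ :=
  sSup {m | eAIter n i m b ≠ none}

noncomputable def phiA (n i : ℕ) (b : Tup n) : ℕ :=
  sSup {m | fAIter n i m b ≠ none}

/-- `ẽ_i` on a tensor product (A case). -/
noncomputable def eTenA (n i : ℕ) (u : Tup n × Tup n) : Option (Tup n × Tup n) :=
  if epsA n i u.2 ≤ phiA n i u.1 then (eA n i u.1).map (fun c => (c, u.2))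
  else (eA n i u.2).map (fun c => (u.1, c))

/-- `f̃_i` on a tensor product (A case). -/
noncomputable def fTenA (n i : ℕ) (u : Tup n × Tup n) : Option (Tup n × Tup n) :=
  if epsA n i u.2 < phiA n i u.1 then (fA n i u.1).map (fun c => (c, u.2))
  else (fA n i u.2).map (fun c => (u.1, c))

/-- `ι : B_l ⊗ B_k → B_k ⊗ B_l` is an isomorphism of `U_q'(A_{2n-1}^{(2)})` crystals. -/
def IsIsoA (n l k : ℕ) (ι : Tup n × Tup n → Tup n × Tup n) : Prop :=
  Set.BijOn ι (BA n l ×ˢ BA n k) (BA n k ×ˢ BA n l) ∧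
  ∀ u ∈ BA n l ×ˢ BA n k, ∀ i ≤ n,
    Option.map ι (eTenA n i u) = eTenA n i (ι u) ∧
    Option.map ι (fTenA n i u) = fTenA n i (ι u)

/-- `H` is an energy function for `ι` (A case), normalized by
`H((l,0,…,0) ⊗ (0,0,---,k)) = 0`. -/
def IsEnergyA (n l k : ℕ) (ι : Tup n × Tup n → Tup n × Tup n)
    (H : Tup n × Tup n → ℤ) : Prop :=
  (∀ u ∈ BA n l ×ˢ BA n k, ∀ i ≤ n, ∀ v, eTenA n i u = some v →
      H v = H u +
        (if i = 0 then
          (if epsA n 0 u.2 ≤ phiA n 0 u.1 ∧ epsA n 0 (ι u).2 ≤ phiA n 0 (ι u).1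
           then 1
           else if phiA n 0 u.1 < epsA n 0 u.2 ∧ phiA n 0 (ι u).1 < epsA n 0 (ι u).2
           then -1 else 0)
         else 0)) ∧
  H (uvec n l, barvec n k) = 0

/-! ### Words, tableaux and column insertion

Letters are encoded as natural numbers: the unbarred letter `j` (for `0 ≤ j ≤ n`) is `j`,
and the barred letter `j̄` is `2n+1-j`; the natural order of `ℕ` is the order
`0 < 1 < ⋯ < n < n̄ < ⋯ < 1̄ < 0̄`.  A (two-row) tableau is encoded as the list of its
columns (left to right), each column being the list of its entries (top to bottom). -/

/-- The barred partner `j̄` of an unbarred letter `j`. -/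
def bar (n j : ℕ) : ℕ := 2 * n + 1 - j

/-- Column insertion of a letter into a tableau with at most two rows. -/
def insertLetter (n : ℕ) : ℕ → List (List ℕ) → List (List ℕ)
  | a, [] => [[a]]
  | a, [p] :: rest =>
      if a ≤ p then [a] :: insertLetter n p rest else [p, a] :: rest
  | a, [p, q] :: rest =>
      if p ≠ 0 ∧ p ≤ n ∧ q = bar n p ∧ p ≤ a ∧ a ≤ q then
        -- the column is a pair `(x, x̄)` with `x ≠ 0` and `x ≤ a ≤ x̄`
        [p - 1, a] :: insertLetter n (bar n (p - 1)) rest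
      else if n + 1 ≤ q ∧ bar n q < p ∧ p < q ∧ a = bar n q ∧ q ≠ n + 1 then
        -- the column is `(β, x̄)` with `x < β < x̄`, `a = x` and `x ≠ n`
        [a + 1, bar n (a + 1)] :: insertLetter n p rest
      else if a ≤ p then [a, q] :: insertLetter n p rest
      else if a ≤ q then [p, a] :: insertLetter n q rest
      else [p, q, a] :: rest
  | a, C :: rest => (C ++ [a]) :: rest

/-- Column insertion of a word `u = u_1 ⋯ u_j` into a tableau: `u_j` first, `u_1` last. -/
def insertWord (n : ℕ) (u : List ℕ) (T : List (List ℕ)) : List (List ℕ) :=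
  u.foldr (fun a T => insertLetter n a T) T

/-- One step of reverse insertion: letter `g` comes back (moving leftward) into a column;
returns the restored column together with the letter passed further left. -/
def revStep (n g : ℕ) (C : List ℕ) : List ℕ × ℕ :=
  match C with
  | [p] => ([g], p)
  | [p, q] =>
      if p ≠ 0 ∧ p ≤ n ∧ q = bar n p ∧ p ≤ g ∧ g ≤ q then
        ([g, bar n (p - 1)], p - 1)
      else if p ≤ n ∧ g = bar n p ∧ p < q ∧ q < g ∧ p ≠ n then
        ([p + 1, bar n (p + 1)], q)
      else if q ≤ g then ([p, g], q)
      else ([g, q], p)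
  | _ => (C, g)

/-- Reverse insertion of a letter through a list of columns, from right to left;
returns the new columns and the letter ejected from the leftmost column. -/
def revPass (n g : ℕ) : List (List ℕ) → List (List ℕ) × ℕ
  | [] => ([], g)
  | C :: rest =>
      let p := revPass n g rest
      let q := revStep n p.2 C
      (q.1 :: p.1, q.2)

/-- Reverse-bump the rightmost cell of the first row (the last column, a single box). -/
def rbFirst (n : ℕ) (T : List (List ℕ)) : List (List ℕ) × ℕ :=
  match T.getLast? with
  | some [a] => revPass n a T.dropLast
  | _ => (T, 0)

/-- Number of columns of height (at least) two, i.e. the length of the second row. -/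
def numTwoCols (T : List (List ℕ)) : ℕ :=
  (T.filter (fun C => decide (2 ≤ C.length))).length

/-- Reverse-bump the rightmost cell of the second row. -/
def rbSecond (n : ℕ) (T : List (List ℕ)) : List (List ℕ) × ℕ :=
  match (T.drop (numTwoCols T - 1)).head? with
  | some [a, b] =>
      let p := revPass n b (T.take (numTwoCols T - 1))
      (p.1 ++ [a] :: T.drop (numTwoCols T), p.2)
  | _ => (T, 0)

/-- Iterate a reverse-bumping step, collecting the ejected letters in order of ejection. -/
def rbIter (step : List (List ℕ) → List (List ℕ) × ℕ) :
    ℕ → List (List ℕ) → List (List ℕ) × List ℕ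
  | 0, T => (T, [])
  | c + 1, T =>
      let p := step T
      let q := rbIter step c p.1
      (q.1, p.2 :: q.2)

/-- A one-row word regarded as a tableau (list of one-box columns). -/
def rowCols (w : List ℕ) : List (List ℕ) := w.map (fun a => [a])

/-- The row word of a one-row tableau. -/
def colsWord (T : List (List ℕ)) : List ℕ := T.foldr (fun C acc => C ++ acc) []

/-- The word `1^{x_1} ⋯ n^{x_n} n̄^{x̄_n} ⋯ 1̄^{x̄_1}`. -/
def coreWord (n : ℕ) (b : Tup n) : List ℕ :=
  ((List.finRange n).map (fun i => List.replicate (b.1 i) ((i : ℕ) + 1))).foldr (· ++ ·) []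
  ++ ((List.finRange n).reverse.map
      (fun i => List.replicate (b.2 i) (bar n ((i : ℕ) + 1)))).foldr (· ++ ·) []

/-- The word `𝕋(b) = 0^{x_0} 1^{x_1} ⋯ 1̄^{x̄_1} 0̄^{x_0}` of an element of the
`C_n^{(1)}` crystal `B_l`. -/
def rowWordC (n l : ℕ) (b : Tup n) : List ℕ :=
  List.replicate (x0 l b) 0 ++ coreWord n b ++ List.replicate (x0 l b) (bar n 0)

/-- The word `𝕋(b)` with `z` pairs `(0, 0̄)` removed. -/
def hatWordC (n l z : ℕ) (b : Tup n) : List ℕ :=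
  List.replicate (x0 l b - z) 0 ++ coreWord n b ++ List.replicate (x0 l b - z) (bar n 0)

/-- The word `𝒯(b) = 1^{x_1} ⋯ 1̄^{x̄_1}` of an element of the `A_{2n-1}^{(2)}` crystal. -/
def rowWordA (n : ℕ) (b : Tup n) : List ℕ := coreWord n b


/-- `ά^l_{l-1}` : add `1` to the entry `x_1`. -/
def acuteA {n : ℕ} (b : Tup n) : Tup n :=
  (fun j => if (j : ℕ) = 0 then b.1 j + 1 else b.1 j, b.2)

/-- `ὰ^l_{l-1}` : add `1` to the entry `x̄_1`. -/
def graveA {n : ℕ} (b : Tup n) : Tup n :=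
  (b.1, fun j => if (j : ℕ) = 0 then b.2 j + 1 else b.2 j)


lemma iter_none {α : Type*} (g : α → Option α) (m : ℕ) :
    (fun o => Option.bind o g)^[m] none = none := by
  induction m with
  | zero => rfl
  | succ m ih => rw [Function.iterate_succ_apply]; simpa using ih

lemma sSup_iter {α : Type*} (g : α → Option α) (r : α → ℕ)
    (h0 : ∀ b, g b = none ↔ r b = 0) (h1 : ∀ b b', g b = some b' → r b' + 1 = r b) (b : α) :
    sSup {m | (fun o => Option.bind o g)^[m] (some b) ≠ none} = r b := by
  have key : ∀ m b, (fun o => Option.bind o g)^[m] (some b) ≠ none ↔ m ≤ r b := by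
    intro m
    induction m with
    | zero => intro b; simp
    | succ m ih =>
      intro b
      rw [Function.iterate_succ_apply]
      show (fun o => Option.bind o g)^[m] (g b) ≠ none ↔ _
      cases hg : g b with
      | none =>
        rw [iter_none]
        have := (h0 b).1 hg
        simp; omega
      | some c =>
        rw [ih c]
        have := h1 b c hg
        omega
  have : {m | (fun o => Option.bind o g)^[m] (some b) ≠ none} = Set.Iic (r b) := by
    ext m; simp only [Set.mem_ofPred_eq, Set.mem_Iic]; exact key m b
  rw [this, csSup_Iic]

def epsF (n i : ℕ) (b : Tup n) : ℕ :=
  if i = 0 then xc b 1 + (xc b 2 - xbc b 2)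
  else if i = n then xbc b n
  else xbc b i + (xc b (i + 1) - xbc b (i + 1))

def phiF (n i : ℕ) (b : Tup n) : ℕ :=
  if i = 0 then xbc b 1 + (xbc b 2 - xc b 2)
  else if i = n then xc b n
  else xc b i + (xbc b (i + 1) - xc b (i + 1))

/-- Coordinate of a function, 1-indexed. -/
def gc {n : ℕ} (f : Fin n → ℕ) (j : ℕ) : ℕ := if h : j - 1 < n then f ⟨j - 1, h⟩ else 0

lemma xc_eq {n : ℕ} (b : Tup n) (j : ℕ) : xc b j = gc b.1 j := rfl
lemma xbc_eq {n : ℕ} (b : Tup n) (j : ℕ) : xbc b j = gc b.2 j := rfl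

lemma gc_setx {n : ℕ} (f : Fin n → ℕ) (j v t : ℕ) (ht : 1 ≤ t) (htn : t ≤ n) :
    gc (setx f j v) t = if t = j then v else gc f t := by
  unfold gc setx
  have : t - 1 < n := by omega
  have h2 : t - 1 + 1 = t := by omega
  simp [this, h2]

lemma tup_ext {n : ℕ} {b c : Tup n} (h1 : ∀ t, 1 ≤ t → t ≤ n → xc b t = xc c t)
    (h2 : ∀ t, 1 ≤ t → t ≤ n → xbc b t = xbc c t) : b = c := by
  refine Prod.ext (funext fun t => ?_) (funext fun t => ?_)
  · have := h1 (t + 1) (by omega) (by omega)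
    simpa [xc] using this
  · have := h2 (t + 1) (by omega) (by omega)
    simpa [xbc] using this

/-- Coordinate description of `ẽ_i`. -/
lemma eA_none {n i : ℕ} (hn : 2 ≤ n) (hi : i ≤ n) (b : Tup n) :
    eA n i b = none ↔ epsF n i b = 0 := by
  unfold eA epsF
  split_ifs <;> simp <;> omega

lemma fA_none {n i : ℕ} (hn : 2 ≤ n) (hi : i ≤ n) (b : Tup n) :
    fA n i b = none ↔ phiF n i b = 0 := by
  unfold fA phiF
  split_ifs <;> simp <;> omega

/-- Relation: `c` is obtained from `b` by a raising move of colour `i`. -/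
def Up (n i : ℕ) (b c : Tup n) : Prop :=
  if i = 0 then
    (xbc b 2 < xc b 2 ∧ (∀ t, 1 ≤ t → t ≤ n → xc b t = xc c t + if t = 2 then 1 else 0) ∧
      (∀ t, 1 ≤ t → t ≤ n → xbc c t = xbc b t + if t = 1 then 1 else 0)) ∨
    (xc b 2 ≤ xbc b 2 ∧ (∀ t, 1 ≤ t → t ≤ n → xc b t = xc c t + if t = 1 then 1 else 0) ∧
      (∀ t, 1 ≤ t → t ≤ n → xbc c t = xbc b t + if t = 2 then 1 else 0))
  else if i = n then
    (∀ t, 1 ≤ t → t ≤ n → xc c t = xc b t + if t = n then 1 else 0) ∧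
      (∀ t, 1 ≤ t → t ≤ n → xbc b t = xbc c t + if t = n then 1 else 0)
  else
    (xbc b (i+1) < xc b (i+1) ∧
      (∀ t, 1 ≤ t → t ≤ n → xc c t + (if t = i + 1 then 1 else 0) = xc b t + if t = i then 1 else 0) ∧
      (∀ t, 1 ≤ t → t ≤ n → xbc c t = xbc b t)) ∨
    (xc b (i+1) ≤ xbc b (i+1) ∧ (∀ t, 1 ≤ t → t ≤ n → xc c t = xc b t) ∧
      (∀ t, 1 ≤ t → t ≤ n → xbc c t + (if t = i then 1 else 0) = xbc b t + if t = i + 1 then 1 else 0))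

lemma eA_up {n i : ℕ} (hn : 2 ≤ n) (hi : i ≤ n) {b c : Tup n} (h : eA n i b = some c) :
    Up n i b c := by
  obtain ⟨b1, b2⟩ := b
  unfold eA at h
  unfold Up
  split_ifs at h <;> try simp only [Option.some.injEq, reduceCtorEq] at h
  all_goals try omega
  all_goals subst h
  all_goals split_ifs
  all_goals simp only [xc_eq, xbc_eq] at *
  · refine Or.inl ⟨by assumption, ?_, ?_⟩ <;> intro t h1 h2 <;>
      simp only [gc_setx _ _ _ _ h1 h2] <;> grind
  · refine Or.inr ⟨by omega, ?_, ?_⟩ <;> intro t h1 h2 <;>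
      simp only [gc_setx _ _ _ _ h1 h2] <;> grind
  · refine ⟨?_, ?_⟩ <;> intro t h1 h2 <;>
      simp only [gc_setx _ _ _ _ h1 h2] <;> grind
  · refine Or.inl ⟨by assumption, ?_, ?_⟩ <;> intro t h1 h2 <;>
      simp only [gc_setx _ _ _ _ h1 h2] <;> grind
  · refine Or.inr ⟨by omega, ?_, ?_⟩ <;> intro t h1 h2 <;>
      simp only [gc_setx _ _ _ _ h1 h2] <;> grind

lemma fA_up {n i : ℕ} (hn : 2 ≤ n) (hi : i ≤ n) {b c : Tup n} (h : fA n i c = some b) :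
    Up n i b c := by
  obtain ⟨c1, c2⟩ := c
  unfold fA at h
  unfold Up
  split_ifs at h <;> try simp only [Option.some.injEq, reduceCtorEq] at h
  all_goals try omega
  all_goals subst h
  all_goals split_ifs
  all_goals simp only [xc_eq, xbc_eq] at *
  · refine Or.inl ⟨?_, ?_, ?_⟩
    · simp only [gc_setx _ _ _ 2 (by omega) hn]; grind
    all_goals
      intro t h1 h2
      simp only [gc_setx _ _ _ _ h1 h2] <;> grind
  · refine Or.inr ⟨?_, ?_, ?_⟩
    · simp only [gc_setx _ _ _ 2 (by omega) hn]; grind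
    all_goals
      intro t h1 h2
      simp only [gc_setx _ _ _ _ h1 h2] <;> grind
  · refine ⟨?_, ?_⟩ <;> intro t h1 h2 <;>
      simp only [gc_setx _ _ _ _ h1 h2] <;> grind
  · have hi1 : i + 1 ≤ n := by omega
    refine Or.inl ⟨?_, ?_, ?_⟩
    · simp only [gc_setx _ _ _ (i+1) (by omega) hi1]; grind
    all_goals
      intro t h1 h2
      simp only [gc_setx _ _ _ _ h1 h2] <;> grind
  · have hi1 : i + 1 ≤ n := by omega
    refine Or.inr ⟨?_, ?_, ?_⟩
    · simp only [gc_setx _ _ _ (i+1) (by omega) hi1]; grind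
    all_goals
      intro t h1 h2
      simp only [gc_setx _ _ _ _ h1 h2] <;> grind

lemma up_inj {n i : ℕ} (hn : 2 ≤ n) (hi : i ≤ n) {b b' c : Tup n} (h : Up n i b c)
    (h' : Up n i b' c) : b = b' := by
  unfold Up at h h'
  split_ifs at h h' with h0 h1
  · have h2 : 1 ≤ 2 := by omega
    rcases h with ⟨a, a1, a2⟩ | ⟨a, a1, a2⟩ <;> rcases h' with ⟨d, d1, d2⟩ | ⟨d, d1, d2⟩ <;>
    have e1 := a1 2 h2 hn <;> have e2 := a2 2 h2 hn <;> have e3 := d1 2 h2 hn <;>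
      have e4 := d2 2 h2 hn <;> simp at e1 e2 e3 e4 <;> first | (exfalso; omega) | skip
    all_goals
      apply tup_ext <;> intro t t1 t2
      · have := a1 t t1 t2; have := d1 t t1 t2; omega
      · have := a2 t t1 t2; have := d2 t t1 t2; omega
  · obtain ⟨a1, a2⟩ := h
    obtain ⟨d1, d2⟩ := h'
    apply tup_ext <;> intro t t1 t2
    · have := a1 t t1 t2; have := d1 t t1 t2; omega
    · have := a2 t t1 t2; have := d2 t t1 t2; omega
  · have h2 : 1 ≤ i + 1 := by omega
    have hn' : i + 1 ≤ n := by omega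
    rcases h with ⟨a, a1, a2⟩ | ⟨a, a1, a2⟩ <;> rcases h' with ⟨d, d1, d2⟩ | ⟨d, d1, d2⟩ <;>
    have e1 := a1 (i+1) h2 hn' <;> have e2 := a2 (i+1) h2 hn' <;> have e3 := d1 (i+1) h2 hn' <;>
      have e4 := d2 (i+1) h2 hn' <;> simp at e1 e2 e3 e4 <;> first | (exfalso; omega) | skip
    all_goals
      apply tup_ext <;> intro t t1 t2
      · have := a1 t t1 t2; have := d1 t t1 t2; omega
      · have := a2 t t1 t2; have := d2 t t1 t2; omega

lemma up_eps {n i : ℕ} (hn : 2 ≤ n) (hi : i ≤ n) {b c : Tup n} (h : Up n i b c) :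
    epsF n i c + 1 = epsF n i b ∧ phiF n i c = phiF n i b + 1 := by
  unfold Up at h
  unfold epsF phiF
  split_ifs at h ⊢ with h0 h1
  · have h2 : 1 ≤ 2 := by omega
    have h3 : 1 ≤ n := by omega
    rcases h with ⟨a, a1, a2⟩ | ⟨a, a1, a2⟩ <;>
    have e1 := a1 2 h2 hn <;> have e2 := a2 2 h2 hn <;> have e3 := a1 1 le_rfl h3 <;>
      have e4 := a2 1 le_rfl h3 <;> simp at e1 e2 e3 e4 <;> omega
  · obtain ⟨a1, a2⟩ := h
    have e1 := a1 n (by omega) le_rfl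
    have e2 := a2 n (by omega) le_rfl
    simp at e1 e2; omega
  · have h2 : 1 ≤ i + 1 := by omega
    have hn' : i + 1 ≤ n := by omega
    have h3 : 1 ≤ i := by omega
    rcases h with ⟨a, a1, a2⟩ | ⟨a, a1, a2⟩ <;>
    have e1 := a1 (i+1) h2 hn' <;> have e2 := a2 (i+1) h2 hn' <;> have e3 := a1 i h3 hi <;>
      have e4 := a2 i h3 hi <;> simp at e1 e2 e3 e4 <;> omega

lemma fA_of_eA {n i : ℕ} (hn : 2 ≤ n) (hi : i ≤ n) {b c : Tup n} (h : eA n i b = some c) :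
    fA n i c = some b := by
  have hu := eA_up hn hi h
  cases hf : fA n i c with
  | none =>
    have := (fA_none hn hi c).1 hf
    have := up_eps hn hi hu
    omega
  | some b' => rw [up_inj hn hi (fA_up hn hi hf) hu]

lemma epsA_eq {n i : ℕ} (hn : 2 ≤ n) (hi : i ≤ n) (b : Tup n) : epsA n i b = epsF n i b :=
  sSup_iter _ _ (eA_none hn hi) (fun _ _ h => (up_eps hn hi (eA_up hn hi h)).1) b

lemma phiA_eq {n i : ℕ} (hn : 2 ≤ n) (hi : i ≤ n) (b : Tup n) : phiA n i b = phiF n i b :=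
  sSup_iter _ _ (fA_none hn hi) (fun _ _ h => (up_eps hn hi (fA_up hn hi h)).2.symm) b

/-- weighted sums -/
def wsum {n : ℕ} (w w' : ℕ → ℕ) (b : Tup n) : ℕ :=
  ∑ t : Fin n, (w (t + 1) * xc b (t + 1) + w' (t + 1) * xbc b (t + 1))

lemma tsum_eq {n : ℕ} (b : Tup n) : tsum b = wsum (fun _ => 1) (fun _ => 1) b := by
  unfold tsum wsum
  simp [xc, xbc]

lemma sum_delta {n : ℕ} (w : ℕ → ℕ) (j : ℕ) (h1 : 1 ≤ j) (h2 : j ≤ n) :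
    ∑ t : Fin n, w (t + 1) * (if (t : ℕ) + 1 = j then 1 else 0) = w j := by
  rw [Finset.sum_eq_single (⟨j - 1, by omega⟩ : Fin n)]
  · have : j - 1 + 1 = j := by omega
    simp [this]
  · intro t _ ht
    have : (t : ℕ) + 1 ≠ j := by
      intro h; apply ht; ext; simp; omega
    simp [this]
  · simp

lemma wsum_step {n : ℕ} (w w' : ℕ → ℕ) (b c : Tup n) (p q p' q' : ℕ → ℕ)
    (h1 : ∀ t, 1 ≤ t → t ≤ n → xc c t + p t = xc b t + q t)
    (h2 : ∀ t, 1 ≤ t → t ≤ n → xbc c t + p' t = xbc b t + q' t) :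
    wsum w w' c + ((∑ t : Fin n, w (t + 1) * p (t + 1)) + ∑ t : Fin n, w' (t + 1) * p' (t + 1)) =
    wsum w w' b + ((∑ t : Fin n, w (t + 1) * q (t + 1)) + ∑ t : Fin n, w' (t + 1) * q' (t + 1)) := by
  unfold wsum
  simp only [← Finset.sum_add_distrib]
  refine Finset.sum_congr rfl fun t _ => ?_
  have e1 := h1 (t + 1) (by omega) (by omega)
  have e2 := h2 (t + 1) (by omega) (by omega)
  have e3 : w (t + 1) * (xc c (t + 1) + p (t + 1)) = w (t + 1) * (xc b (t + 1) + q (t + 1)) := by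
    rw [e1]
  have e4 : w' (t + 1) * (xbc c (t + 1) + p' (t + 1)) = w' (t + 1) * (xbc b (t + 1) + q' (t + 1)) := by
    rw [e2]
  simp only [mul_add] at e3 e4
  omega

lemma up_wsum {n i : ℕ} (hn : 2 ≤ n) (hi : i ≤ n) {b c : Tup n} (h : Up n i b c) (w w' : ℕ → ℕ) :
    (i = 0 ∧ (wsum w w' c + w 2 = wsum w w' b + w' 1 ∨ wsum w w' c + w 1 = wsum w w' b + w' 2)) ∨
    (i = n ∧ wsum w w' c + w' n = wsum w w' b + w n) ∨
    (1 ≤ i ∧ i < n ∧ (wsum w w' c + w (i+1) = wsum w w' b + w i ∨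
      wsum w w' c + w' i = wsum w w' b + w' (i+1))) := by
  unfold Up at h
  split_ifs at h with h0 h1
  · left
    refine ⟨h0, ?_⟩
    rcases h with ⟨a, a1, a2⟩ | ⟨a, a1, a2⟩
    · left
      have := wsum_step w w' b c (fun t => if t = 2 then 1 else 0) (fun _ => 0) (fun _ => 0)
        (fun t => if t = 1 then 1 else 0) (fun t u v => by rw [a1 t u v]; simp)
        (fun t u v => by rw [a2 t u v]; simp)
      rw [sum_delta w 2 (by omega) hn, sum_delta w' 1 (by omega) (by omega)] at this
      simpa using this
    · right
      have := wsum_step w w' b c (fun t => if t = 1 then 1 else 0) (fun _ => 0) (fun _ => 0)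
        (fun t => if t = 2 then 1 else 0) (fun t u v => by rw [a1 t u v]; simp)
        (fun t u v => by rw [a2 t u v]; simp)
      rw [sum_delta w 1 (by omega) (by omega), sum_delta w' 2 (by omega) hn] at this
      simpa using this
  · right; left
    refine ⟨h1, ?_⟩
    obtain ⟨a1, a2⟩ := h
    have := wsum_step w w' b c (fun _ => 0) (fun t => if t = n then 1 else 0)
        (fun t => if t = n then 1 else 0) (fun _ => 0) (fun t u v => by rw [a1 t u v]; simp)
        (fun t u v => by rw [a2 t u v]; simp)
    rw [sum_delta w n (by omega) le_rfl, sum_delta w' n (by omega) le_rfl] at this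
    simpa using this
  · right; right
    refine ⟨by omega, by omega, ?_⟩
    rcases h with ⟨a, a1, a2⟩ | ⟨a, a1, a2⟩
    · left
      have := wsum_step w w' b c (fun t => if t = i+1 then 1 else 0)
        (fun t => if t = i then 1 else 0) (fun _ => 0) (fun _ => 0) a1 (fun t u v => by rw [a2 t u v])
      rw [sum_delta w (i+1) (by omega) (by omega), sum_delta w i (by omega) (by omega)] at this
      simpa using this
    · right
      have := wsum_step w w' b c (fun _ => 0) (fun _ => 0) (fun t => if t = i then 1 else 0)
        (fun t => if t = i+1 then 1 else 0)  (fun t u v => by rw [a1 t u v]) a2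
      rw [sum_delta w' (i+1) (by omega) (by omega), sum_delta w' i (by omega) (by omega)] at this
      simpa using this

lemma up_tsum {n i : ℕ} (hn : 2 ≤ n) (hi : i ≤ n) {b c : Tup n} (h : Up n i b c) :
    tsum c = tsum b := by
  have := up_wsum hn hi h (fun _ => 1) (fun _ => 1)
  rw [← tsum_eq, ← tsum_eq] at this
  omega

def mu (n : ℕ) (b : Tup n) : ℕ := wsum (fun t => t) (fun t => 2 * n + 1 - t) b

lemma up_mu {n i : ℕ} (hn : 2 ≤ n) (hi : i ≤ n) (hi1 : 1 ≤ i) {b c : Tup n} (h : Up n i b c) :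
    mu n c < mu n b := by
  have := up_wsum hn hi h (fun t => t) (fun t => 2 * n + 1 - t)
  unfold mu
  omega

lemma up_one {n i : ℕ} (hn : 2 ≤ n) (hi1 : 2 ≤ i) {b c : Tup n} (h : Up n i b c) :
    xc c 1 = xc b 1 ∧ xbc c 1 = xbc b 1 := by
  have h3 : 1 ≤ n := by omega
  unfold Up at h
  split_ifs at h with h0 h1
  · omega
  · have e1 := h.1 1 le_rfl h3
    have e2 := h.2 1 le_rfl h3
    split_ifs at e1 e2 <;> omega
  · rcases h with ⟨a, a1, a2⟩ | ⟨a, a1, a2⟩ <;>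
    have e1 := a1 1 le_rfl h3 <;> have e2 := a2 1 le_rfl h3 <;> split_ifs at e1 e2 <;> omega

/-! coordinates of special vectors -/

lemma xc_triple {n a c d : ℕ} (t : ℕ) (ht : 1 ≤ t) (htn : t ≤ n) :
    xc (tripleVec n a c d) t = if t = 1 then a else if t = 2 then c else 0 := by
  unfold xc tripleVec
  have : t - 1 < n := by omega
  simp only [this, dif_pos]
  split_ifs <;> omega

lemma xbc_triple {n a c d : ℕ} (t : ℕ) (ht : 1 ≤ t) (htn : t ≤ n) :
    xbc (tripleVec n a c d) t = if t = 1 then d else 0 := by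
  unfold xbc tripleVec
  have : t - 1 < n := by omega
  simp only [this, dif_pos]
  split_ifs <;> omega

lemma uvec_eq (n v : ℕ) : uvec n v = tripleVec n v 0 0 := by
  unfold uvec tripleVec; simp

lemma barvec_eq (n v : ℕ) : barvec n v = tripleVec n 0 0 v := by
  unfold barvec tripleVec; simp

lemma tsum_triple {n a c d : ℕ} (hn : 2 ≤ n) : tsum (tripleVec n a c d) = a + c + d := by
  have := wsum_step (n := n) (fun _ => 1) (fun _ => 1) (tripleVec n 0 0 0) (tripleVec n a c d)
    (fun _ => 0) (fun t => a * (if t = 1 then 1 else 0) + c * (if t = 2 then 1 else 0))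
    (fun _ => 0) (fun t => d * (if t = 1 then 1 else 0))
    (fun t u v => by rw [xc_triple t u v, xc_triple t u v]; split_ifs <;> omega)
    (fun t u v => by rw [xbc_triple t u v, xbc_triple t u v]; split_ifs <;> omega)
  have h0 : tsum (tripleVec n 0 0 0) = 0 := by simp [tsum, tripleVec]
  rw [← tsum_eq, ← tsum_eq, h0] at this
  have k1 := sum_delta (n := n) (fun _ => 1) 1 le_rfl (by omega)
  have k2 := sum_delta (n := n) (fun _ => 1) 2 (by omega) hn
  simp only [one_mul, Finset.sum_add_distrib, ← Finset.mul_sum] at this k1 k2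
  rw [k1, k2] at this
  simpa using this

lemma eps_triple {n a c d i : ℕ} (hn : 2 ≤ n) (hi : i ≤ n) : epsF n i (tripleVec n a c d) =
    if i = 0 then a + c else if i = 1 then d + c else 0 := by
  have h1 : 1 ≤ n := by omega
  unfold epsF
  split_ifs
  · rw [xc_triple 1 le_rfl h1, xc_triple 2 (by omega) hn, xbc_triple 2 (by omega) hn]; simp
  · omega
  · rw [xbc_triple n h1 le_rfl]; split_ifs <;> omega
  · rw [xc_triple (i+1) (by omega) (by omega), xbc_triple (i+1) (by omega) (by omega),
      xbc_triple i (by omega) (by omega)]; simp [*]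
  · rw [xc_triple (i+1) (by omega) (by omega), xbc_triple (i+1) (by omega) (by omega),
      xbc_triple i (by omega) (by omega)]; split_ifs <;> omega

lemma phi_triple {n a c d i : ℕ} (hn : 2 ≤ n) (hi : i ≤ n) : phiF n i (tripleVec n a c d) =
    if i = 0 then d else if i = 1 then a else if i = 2 then c else 0 := by
  have h1 : 1 ≤ n := by omega
  unfold phiF
  split_ifs
  any_goals omega
  · rw [xbc_triple 1 le_rfl h1, xc_triple 2 (by omega) hn, xbc_triple 2 (by omega) hn]; simp
  · rw [xc_triple n h1 le_rfl]; split_ifs <;> omega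
  · rw [xc_triple n h1 le_rfl]; split_ifs <;> omega
  all_goals
    rw [xc_triple (i+1) (by omega) (by omega), xbc_triple (i+1) (by omega) (by omega),
      xc_triple i (by omega) (by omega)]; split_ifs <;> omega

lemma triple_of_eps {n : ℕ} (b : Tup n)
    (h : ∀ i, 2 ≤ i → i ≤ n → epsF n i b = 0) :
    b = tripleVec n (xc b 1) (xc b 2) (xbc b 1) := by
  have hb : ∀ i, 2 ≤ i → i ≤ n → xbc b i = 0 := by
    intro i h1 h2
    have := h i h1 h2
    unfold epsF at this
    split_ifs at this with k1 k2
    · omega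
    · rw [k2]; exact this
    · omega
  have hx : ∀ i, 3 ≤ i → i ≤ n → xc b i = 0 := by
    intro i h1 h2
    have := h (i-1) (by omega) (by omega)
    unfold epsF at this
    have e : i - 1 + 1 = i := by omega
    have h3 := hb i (by omega) h2
    rw [e] at this
    split_ifs at this <;> omega
  apply tup_ext <;> intro t t1 t2
  · rw [xc_triple t t1 t2]
    split_ifs with k k
    · rw [k]
    · rw [k]
    · exact hx t (by omega) t2
  · rw [xbc_triple t t1 t2]
    split_ifs with k
    · rw [k]
    · exact hb t (by omega) t2

lemma up_inj' {n i : ℕ} {b c c' : Tup n} (h : Up n i b c)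
    (h' : Up n i b c') : c = c' := by
  unfold Up at h h'
  split_ifs at h h' with h0 h1
  · rcases h with ⟨a, a1, a2⟩ | ⟨a, a1, a2⟩ <;> rcases h' with ⟨d, d1, d2⟩ | ⟨d, d1, d2⟩ <;>
      first | (exfalso; omega) | skip
    all_goals
      apply tup_ext <;> intro t t1 t2
      · have := a1 t t1 t2; have := d1 t t1 t2; omega
      · have := a2 t t1 t2; have := d2 t t1 t2; omega
  · obtain ⟨a1, a2⟩ := h
    obtain ⟨d1, d2⟩ := h'
    apply tup_ext <;> intro t t1 t2
    · have := a1 t t1 t2; have := d1 t t1 t2; omega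
    · have := a2 t t1 t2; have := d2 t t1 t2; omega
  · rcases h with ⟨a, a1, a2⟩ | ⟨a, a1, a2⟩ <;> rcases h' with ⟨d, d1, d2⟩ | ⟨d, d1, d2⟩ <;>
      first | (exfalso; omega) | skip
    all_goals
      apply tup_ext <;> intro t t1 t2
      · have := a1 t t1 t2; have := d1 t t1 t2; omega
      · have := a2 t t1 t2; have := d2 t t1 t2; omega

lemma eA_iff {n i : ℕ} (hn : 2 ≤ n) (hi : i ≤ n) {b c : Tup n} :
    eA n i b = some c ↔ Up n i b c := by
  refine ⟨eA_up hn hi, fun h => ?_⟩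
  cases hf : eA n i b with
  | none =>
    have := (eA_none hn hi b).1 hf
    have := up_eps hn hi h
    omega
  | some c' => rw [up_inj' (eA_up hn hi hf) h]

lemma fA_iff {n i : ℕ} (hn : 2 ≤ n) (hi : i ≤ n) {b c : Tup n} :
    fA n i c = some b ↔ Up n i b c :=
  ⟨fA_up hn hi, fun h => fA_of_eA hn hi ((eA_iff hn hi).2 h)⟩

/-! `acute` and `grave` -/

lemma xc_acute {n : ℕ} (b : Tup n) (t : ℕ) (ht : 1 ≤ t) (htn : t ≤ n) :
    xc (acuteA b) t = xc b t + if t = 1 then 1 else 0 := by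
  unfold xc acuteA
  have : t - 1 < n := by omega
  simp only [this, dif_pos]
  split_ifs <;> omega

lemma xbc_acute {n : ℕ} (b : Tup n) (t : ℕ) : xbc (acuteA b) t = xbc b t := rfl

lemma xbc_grave {n : ℕ} (b : Tup n) (t : ℕ) (ht : 1 ≤ t) (htn : t ≤ n) :
    xbc (graveA b) t = xbc b t + if t = 1 then 1 else 0 := by
  unfold xbc graveA
  have : t - 1 < n := by omega
  simp only [this, dif_pos]
  split_ifs <;> omega

lemma xc_grave {n : ℕ} (b : Tup n) (t : ℕ) : xc (graveA b) t = xc b t := rfl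

lemma up_acute {n i : ℕ} (hn : 2 ≤ n) (hi : i ≤ n) {b c : Tup n} (h : Up n i b c) :
    Up n i (acuteA b) (acuteA c) := by
  unfold Up at h ⊢
  simp only [xbc_acute]
  split_ifs at h ⊢ with h0 h1
  · rw [xc_acute b 2 (by omega) hn]
    rcases h with ⟨a, a1, a2⟩ | ⟨a, a1, a2⟩
    · refine Or.inl ⟨by simpa using a, fun t t1 t2 => ?_, a2⟩
      rw [xc_acute b t t1 t2, xc_acute c t t1 t2]
      have := a1 t t1 t2
      omega
    · refine Or.inr ⟨by simpa using a, fun t t1 t2 => ?_, a2⟩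
      rw [xc_acute b t t1 t2, xc_acute c t t1 t2]
      have := a1 t t1 t2
      omega
  · refine ⟨fun t t1 t2 => ?_, h.2⟩
    rw [xc_acute b t t1 t2, xc_acute c t t1 t2]
    have := h.1 t t1 t2
    omega
  · rw [xc_acute b (i+1) (by omega) (by omega)]
    rcases h with ⟨a, a1, a2⟩ | ⟨a, a1, a2⟩
    · refine Or.inl ⟨by omega, fun t t1 t2 => ?_, a2⟩
      rw [xc_acute b t t1 t2, xc_acute c t t1 t2]
      have := a1 t t1 t2
      omega
    · refine Or.inr ⟨by rw [if_neg (by omega)]; omega, fun t t1 t2 => ?_, a2⟩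
      rw [xc_acute b t t1 t2, xc_acute c t t1 t2]
      have := a1 t t1 t2
      omega

lemma up_grave {n i : ℕ} (hn : 2 ≤ n) (hi : i ≤ n) {b c : Tup n} (h : Up n i b c) :
    Up n i (graveA b) (graveA c) := by
  unfold Up at h ⊢
  simp only [xc_grave]
  split_ifs at h ⊢ with h0 h1
  · rw [xbc_grave b 2 (by omega) hn]
    rcases h with ⟨a, a1, a2⟩ | ⟨a, a1, a2⟩
    · refine Or.inl ⟨by simpa using a, a1, fun t t1 t2 => ?_⟩
      rw [xbc_grave b t t1 t2, xbc_grave c t t1 t2]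
      have := a2 t t1 t2
      omega
    · refine Or.inr ⟨by simpa using a, a1, fun t t1 t2 => ?_⟩
      rw [xbc_grave b t t1 t2, xbc_grave c t t1 t2]
      have := a2 t t1 t2
      omega
  · refine ⟨h.1, fun t t1 t2 => ?_⟩
    rw [xbc_grave b t t1 t2, xbc_grave c t t1 t2]
    have := h.2 t t1 t2
    omega
  · rw [xbc_grave b (i+1) (by omega) (by omega)]
    rcases h with ⟨a, a1, a2⟩ | ⟨a, a1, a2⟩
    · refine Or.inl ⟨by rw [if_neg (by omega)]; omega, a1, fun t t1 t2 => ?_⟩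
      rw [xbc_grave b t t1 t2, xbc_grave c t t1 t2]
      have := a2 t t1 t2
      omega
    · refine Or.inr ⟨by omega, a1, fun t t1 t2 => ?_⟩
      rw [xbc_grave b t t1 t2, xbc_grave c t t1 t2]
      have := a2 t t1 t2
      omega

lemma phi_acute {n i : ℕ} (hn : 2 ≤ n) (hi : i ≤ n) (b : Tup n) :
    phiF n i (acuteA b) = phiF n i b + if i = 1 then 1 else 0 := by
  unfold phiF
  simp only [xbc_acute]
  split_ifs with h0 h1 h2 h3 h4
  any_goals omega
  · rw [xc_acute b 2 (by omega) hn]; simp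
  · rw [xc_acute b n (by omega) le_rfl, if_neg (by omega)]
  · rw [xc_acute b (i+1) (by omega) (by omega), xc_acute b i (by omega) hi,
      if_neg (show ¬ i + 1 = 1 by omega), if_pos h4]; omega
  · rw [xc_acute b (i+1) (by omega) (by omega), xc_acute b i (by omega) hi,
      if_neg (show ¬ i + 1 = 1 by omega), if_neg h4]; omega

lemma eps_grave {n i : ℕ} (hn : 2 ≤ n) (hi : i ≤ n) (b : Tup n) :
    epsF n i (graveA b) = epsF n i b + if i = 1 then 1 else 0 := by
  unfold epsF
  simp only [xc_grave]
  split_ifs with h0 h1 h2 h3 h4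
  any_goals omega
  · rw [xbc_grave b 2 (by omega) hn]; simp
  · rw [xbc_grave b n (by omega) le_rfl, if_neg (by omega)]
  · rw [xbc_grave b (i+1) (by omega) (by omega), xbc_grave b i (by omega) hi,
      if_neg (show ¬ i + 1 = 1 by omega), if_pos h4]; omega
  · rw [xbc_grave b (i+1) (by omega) (by omega), xbc_grave b i (by omega) hi,
      if_neg (show ¬ i + 1 = 1 by omega), if_neg h4]; omega

lemma acute_triple (n a c d : ℕ) : acuteA (tripleVec n a c d) = tripleVec n (a+1) c d := by
  unfold acuteA tripleVec
  refine Prod.ext (funext fun t => ?_) rfl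
  simp only
  split_ifs <;> rfl

lemma grave_triple (n a c d : ℕ) : graveA (tripleVec n a c d) = tripleVec n a c (d+1) := by
  unfold graveA tripleVec
  refine Prod.ext rfl (funext fun t => ?_)
  simp only
  split_ifs <;> rfl

lemma tsum_acute {n : ℕ} (hn : 2 ≤ n) (b : Tup n) : tsum (acuteA b) = tsum b + 1 := by
  have := wsum_step (n := n) (fun _ => 1) (fun _ => 1) b (acuteA b) (fun _ => 0)
    (fun t => if t = 1 then 1 else 0) (fun _ => 0) (fun _ => 0)
    (fun t u v => by rw [xc_acute b t u v]; rfl) (fun t u v => by rw [xbc_acute])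
  rw [sum_delta (n := n) (fun _ => 1) 1 le_rfl (by omega), ← tsum_eq, ← tsum_eq] at this
  simpa using this

lemma tsum_grave {n : ℕ} (hn : 2 ≤ n) (b : Tup n) : tsum (graveA b) = tsum b + 1 := by
  have := wsum_step (n := n) (fun _ => 1) (fun _ => 1) b (graveA b) (fun _ => 0) (fun _ => 0)
    (fun _ => 0) (fun t => if t = 1 then 1 else 0)
    (fun t u v => by rw [xc_grave]) (fun t u v => by rw [xbc_grave b t u v]; rfl)
  rw [sum_delta (n := n) (fun _ => 1) 1 le_rfl (by omega), ← tsum_eq, ← tsum_eq] at this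
  simpa using this

/-! Tensor products -/

lemma eTen_iff {n i : ℕ} (hn : 2 ≤ n) (hi : i ≤ n) {u v : Tup n × Tup n} :
    eTenA n i u = some v ↔
    (epsF n i u.2 ≤ phiF n i u.1 ∧ Up n i u.1 v.1 ∧ v.2 = u.2) ∨
    (phiF n i u.1 < epsF n i u.2 ∧ Up n i u.2 v.2 ∧ v.1 = u.1) := by
  obtain ⟨v1, v2⟩ := v
  unfold eTenA
  rw [epsA_eq hn hi, phiA_eq hn hi]
  split_ifs with h
  · simp only [Option.map_eq_some_iff, Prod.mk.injEq, eA_iff hn hi]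
    constructor
    · rintro ⟨a, h1, rfl, rfl⟩; exact Or.inl ⟨h, h1, rfl⟩
    · rintro (⟨_, h1, h2⟩ | ⟨h1, _⟩)
      · exact ⟨v1, h1, rfl, h2.symm⟩
      · omega
  · simp only [Option.map_eq_some_iff, Prod.mk.injEq, eA_iff hn hi]
    constructor
    · rintro ⟨a, h1, rfl, rfl⟩; exact Or.inr ⟨by omega, h1, rfl⟩
    · rintro (⟨h1, _⟩ | ⟨_, h1, h2⟩)
      · omega
      · exact ⟨v2, h1, h2.symm, rfl⟩

lemma fTen_iff {n i : ℕ} (hn : 2 ≤ n) (hi : i ≤ n) {u v : Tup n × Tup n} :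
    fTenA n i v = some u ↔
    (epsF n i v.2 < phiF n i v.1 ∧ Up n i u.1 v.1 ∧ u.2 = v.2) ∨
    (phiF n i v.1 ≤ epsF n i v.2 ∧ Up n i u.2 v.2 ∧ u.1 = v.1) := by
  obtain ⟨u1, u2⟩ := u
  unfold fTenA
  rw [epsA_eq hn hi, phiA_eq hn hi]
  split_ifs with h
  · simp only [Option.map_eq_some_iff, Prod.mk.injEq, fA_iff hn hi]
    constructor
    · rintro ⟨a, h1, rfl, rfl⟩; exact Or.inl ⟨h, h1, rfl⟩
    · rintro (⟨_, h1, h2⟩ | ⟨h1, _⟩)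
      · exact ⟨u1, h1, rfl, h2.symm⟩
      · omega
  · simp only [Option.map_eq_some_iff, Prod.mk.injEq, fA_iff hn hi]
    constructor
    · rintro ⟨a, h1, rfl, rfl⟩; exact Or.inr ⟨by omega, h1, rfl⟩
    · rintro (⟨h1, _⟩ | ⟨_, h1, h2⟩)
      · omega
      · exact ⟨u2, h1, h2.symm, rfl⟩

lemma fTen_of_eTen {n i : ℕ} (hn : 2 ≤ n) (hi : i ≤ n) {u v : Tup n × Tup n}
    (h : eTenA n i u = some v) : fTenA n i v = some u := by
  rw [eTen_iff hn hi] at h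
  rw [fTen_iff hn hi]
  rcases h with ⟨h1, h2, h3⟩ | ⟨h1, h2, h3⟩
  · left
    have := up_eps hn hi h2
    rw [h3]
    exact ⟨by omega, h2, rfl⟩
  · right
    have := up_eps hn hi h2
    rw [h3]
    exact ⟨by omega, h2, rfl⟩

def epsT (n i : ℕ) (u : Tup n × Tup n) : ℕ := epsF n i u.1 + (epsF n i u.2 - phiF n i u.1)

lemma eTen_none {n i : ℕ} (hn : 2 ≤ n) (hi : i ≤ n) (u : Tup n × Tup n) :
    eTenA n i u = none ↔ epsT n i u = 0 := by
  unfold eTenA epsT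
  rw [epsA_eq hn hi, phiA_eq hn hi]
  split_ifs with h <;> simp [eA_none hn hi] <;> omega

lemma eTen_eps {n i : ℕ} (hn : 2 ≤ n) (hi : i ≤ n) {u v : Tup n × Tup n}
    (h : eTenA n i u = some v) : epsT n i v + 1 = epsT n i u := by
  rw [eTen_iff hn hi] at h
  unfold epsT
  rcases h with ⟨h1, h2, h3⟩ | ⟨h1, h2, h3⟩ <;> have := up_eps hn hi h2 <;> rw [h3] <;> omega

lemma eTen_mem {n i l k : ℕ} (hn : 2 ≤ n) (hi : i ≤ n) {u v : Tup n × Tup n}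
    (h : eTenA n i u = some v) (hu : u ∈ BA n l ×ˢ BA n k) : v ∈ BA n l ×ˢ BA n k := by
  rw [eTen_iff hn hi] at h
  obtain ⟨m1, m2⟩ := hu
  change tsum u.1 = l at m1
  change tsum u.2 = k at m2
  rcases h with ⟨h1, h2, h3⟩ | ⟨h1, h2, h3⟩ <;> have h4 := up_tsum hn hi h2
  · exact ⟨h4.trans m1, (congrArg tsum h3).trans m2⟩
  · exact ⟨(congrArg tsum h3).trans m1, h4.trans m2⟩

def Phi {n : ℕ} (u : Tup n × Tup n) : Tup n × Tup n := (acuteA u.1, graveA u.2)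

lemma eTen_Phi {n i : ℕ} (hn : 2 ≤ n) (hi : i ≤ n) {u v : Tup n × Tup n}
    (h : eTenA n i u = some v) : eTenA n i (Phi u) = some (Phi v) := by
  rw [eTen_iff hn hi] at h ⊢
  simp only [Phi, phi_acute hn hi, eps_grave hn hi]
  rcases h with ⟨h1, h2, h3⟩ | ⟨h1, h2, h3⟩
  · exact Or.inl ⟨by omega, up_acute hn hi h2, by rw [h3]⟩
  · exact Or.inr ⟨by omega, up_grave hn hi h2, by rw [h3]⟩

lemma fTen_Phi {n i : ℕ} (hn : 2 ≤ n) (hi : i ≤ n) {u v : Tup n × Tup n}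
    (h : fTenA n i u = some v) : fTenA n i (Phi u) = some (Phi v) := by
  rw [fTen_iff hn hi] at h ⊢
  simp only [Phi, phi_acute hn hi, eps_grave hn hi]
  rcases h with ⟨h1, h2, h3⟩ | ⟨h1, h2, h3⟩
  · exact Or.inl ⟨by omega, up_acute hn hi h2, by rw [h3]⟩
  · exact Or.inr ⟨by omega, up_grave hn hi h2, by rw [h3]⟩

/-! Reachability -/

def StepE (n : ℕ) (u v : Tup n × Tup n) : Prop := ∃ i ≤ n, eTenA n i u = some v

abbrev Reach (n : ℕ) := Relation.ReflTransGen (StepE n)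

def topT (n l k : ℕ) : Tup n × Tup n :=
  (tripleVec n l 0 0, tripleVec n (k - min l k) 0 (min l k))

/-- shape of classically highest elements -/
lemma highest_shape {n l k : ℕ} (hn : 2 ≤ n) {u : Tup n × Tup n} (hu : u ∈ BA n l ×ˢ BA n k)
    (h : ∀ i, 1 ≤ i → i ≤ n → epsT n i u = 0) :
    ∃ a c d, c + d ≤ l ∧ a + c + d = k ∧ u = (tripleVec n l 0 0, tripleVec n a c d) := by
  obtain ⟨u1, u2⟩ := u
  obtain ⟨m1, m2⟩ := hu
  change tsum u1 = l at m1
  change tsum u2 = k at m2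
  simp only [epsT] at h
  have e1 := triple_of_eps u1 (fun i h1 h2 => by have := h i (by omega) h2; omega)
  generalize xc u1 1 = a at e1
  generalize xc u1 2 = c at e1
  generalize xbc u1 1 = d at e1
  subst e1
  have h1 := h 1 le_rfl (by omega)
  rw [eps_triple hn (by omega), phi_triple hn (by omega)] at h1
  simp only [one_ne_zero, if_false, if_true] at h1
  have : c = 0 := by omega
  subst this
  have : d = 0 := by omega
  subst this
  rw [tsum_triple hn] at m1
  have : a = l := by omega
  subst this
  have e2 := triple_of_eps u2 (fun i h1 h2 => by
    have := h i (by omega) h2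
    rw [phi_triple hn h2] at this
    split_ifs at this <;> omega)
  generalize xc u2 1 = a' at e2
  generalize xc u2 2 = c' at e2
  generalize xbc u2 1 = d' at e2
  subst e2
  rw [eps_triple hn (by omega)] at h1
  simp only [one_ne_zero, if_false, if_true] at h1
  rw [tsum_triple hn] at m2
  exact ⟨a', c', d', by omega, m2, rfl⟩

lemma reach_A {n l k : ℕ} (hn : 2 ≤ n) (N : ℕ) : ∀ u ∈ BA n l ×ˢ BA n k, mu n u.1 + mu n u.2 = N →
    ∃ a c d, c + d ≤ l ∧ a + c + d = k ∧
      Reach n u (tripleVec n l 0 0, tripleVec n a c d) := by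
  induction N using Nat.strong_induction_on with
  | _ N ih =>
  intro u hu hN
  by_cases h : ∀ i, 1 ≤ i → i ≤ n → epsT n i u = 0
  · obtain ⟨a, c, d, h1, h2, h3⟩ := highest_shape hn hu h
    refine ⟨a, c, d, h1, h2, ?_⟩
    rw [h3]
  · push Not at h
    obtain ⟨i, hi1, hi, h⟩ := h
    rw [Ne, ← eTen_none hn hi] at h
    obtain ⟨v, hv⟩ := Option.ne_none_iff_exists'.1 h
    have hm : mu n v.1 + mu n v.2 < N := by
      have := (eTen_iff hn hi).1 hv
      rcases this with ⟨h1, h2, h3⟩ | ⟨h1, h2, h3⟩ <;> have := up_mu hn hi hi1 h2 <;> rw [h3] <;>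
        omega
    obtain ⟨a, c, d, h1, h2, h3⟩ := ih _ hm v (eTen_mem hn hi hv hu) rfl
    exact ⟨a, c, d, h1, h2, Relation.ReflTransGen.head ⟨i, hi, hv⟩ h3⟩

lemma reach_B {n l : ℕ} (hn : 2 ≤ n) (N : ℕ) : ∀ b : Tup n, mu n b = N →
    ∃ c, xc b 1 + c + xbc b 1 = tsum b ∧
      Reach n (tripleVec n l 0 0, b) (tripleVec n l 0 0, tripleVec n (xc b 1) c (xbc b 1)) := by
  induction N using Nat.strong_induction_on with
  | _ N ih =>
  intro b hN
  by_cases h : ∀ i, 2 ≤ i → i ≤ n → epsF n i b = 0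
  · have h1 := triple_of_eps b h
    refine ⟨xc b 2, ?_, ?_⟩
    · have := congrArg tsum h1
      rw [tsum_triple hn] at this
      exact this.symm
    · rw [← h1]
  · push Not at h
    obtain ⟨i, hi1, hi, h⟩ := h
    have h' := h
    rw [Ne, ← eA_none hn hi] at h
    obtain ⟨v, hv⟩ := Option.ne_none_iff_exists'.1 h
    have hup := (eA_iff hn hi).1 hv
    have hm := up_mu hn hi (by omega) hup
    obtain ⟨c, h1, h2⟩ := ih _ (hN ▸ hm) v rfl
    obtain ⟨o1, o2⟩ := up_one hn hi1 hup
    rw [o1, o2] at h1 h2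
    rw [up_tsum hn hi hup] at h1
    refine ⟨c, h1, Relation.ReflTransGen.head ⟨i, hi, ?_⟩ h2⟩
    rw [eTen_iff hn hi]
    refine Or.inr ⟨?_, hup, rfl⟩
    simp only [phi_triple hn hi]
    split_ifs <;> omega

lemma up_zero_triple {n a c d : ℕ} (hn : 2 ≤ n) :
    Up n 0 (tripleVec n a (c+1) d) (tripleVec n a c (d+1)) := by
  unfold Up
  rw [if_pos rfl]
  left
  refine ⟨?_, ?_, ?_⟩
  · rw [xbc_triple 2 (by omega) hn, xc_triple 2 (by omega) hn]; simp
  · intro t t1 t2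
    rw [xc_triple t t1 t2, xc_triple t t1 t2]; split_ifs <;> omega
  · intro t t1 t2
    rw [xbc_triple t t1 t2, xbc_triple t t1 t2]; split_ifs <;> omega

lemma reach_C {n l k : ℕ} (hn : 2 ≤ n) (N : ℕ) : ∀ a c d, c + d ≤ l → a + c + d = k →
    2 * a + c = N → Reach n (tripleVec n l 0 0, tripleVec n a c d) (topT n l k) := by
  induction N using Nat.strong_induction_on with
  | _ N ih =>
  intro a c d h1 h2 hN
  have key : ∀ x, Up n 0 (tripleVec n a c d) x → 0 < a + c →
      StepE n (tripleVec n l 0 0, tripleVec n a c d) (tripleVec n l 0 0, x) := by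
    intro x hx hac
    refine ⟨0, by omega, ?_⟩
    rw [eTen_iff hn (by omega)]
    refine Or.inr ⟨?_, hx, rfl⟩
    simp only [phi_triple hn (Nat.zero_le n), eps_triple hn (Nat.zero_le n), if_true]
    exact hac
  rcases c with _ | c
  · by_cases h : 0 < a ∧ d < l
    · have he : eA n 0 (tripleVec n a 0 d) ≠ none := by
        rw [Ne, eA_none hn (by omega), eps_triple hn (by omega)]; simp; omega
      obtain ⟨x, hx⟩ := Option.ne_none_iff_exists'.1 he
      have hup := (eA_iff hn (by omega)).1 hx
      have s1 := key x hup (by omega)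
      obtain ⟨c', h3, h4⟩ := reach_B (l := l) hn _ x rfl
      rw [up_tsum hn (by omega) hup, tsum_triple hn] at h3
      have hx1 : xc x 1 + 1 = a ∧ xbc x 1 = d := by
        unfold Up at hup
        rw [if_pos rfl] at hup
        have l1 : 1 ≤ n := by omega
        rcases hup with ⟨p, q, r⟩ | ⟨p, q, r⟩
        · rw [xbc_triple 2 (by omega) hn, xc_triple 2 (by omega) hn] at p; simp at p
        · have q1 := q 1 le_rfl l1
          have r1 := r 1 le_rfl l1
          rw [xc_triple 1 le_rfl l1] at q1
          rw [xbc_triple 1 le_rfl l1] at r1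
          simp at q1 r1
          exact ⟨q1.symm, r1⟩
      exact (Relation.ReflTransGen.head s1 h4).trans
        (ih _ (by omega) (xc x 1) c' (xbc x 1) (by omega) (by omega) rfl)
    · have e1 : min l k = d := by omega
      have e2 : k - d = a := by omega
      unfold topT
      rw [e1, e2]
  · exact Relation.ReflTransGen.head (key _ (up_zero_triple hn) (by omega))
      (ih _ (by omega) a c (d+1) (by omega) (by omega) rfl)

lemma reach_top {n l k : ℕ} (hn : 2 ≤ n) {u : Tup n × Tup n} (hu : u ∈ BA n l ×ˢ BA n k) :
    Reach n u (topT n l k) := by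
  obtain ⟨a, c, d, h1, h2, h3⟩ := reach_A hn _ u hu rfl
  exact h3.trans (reach_C hn _ a c d h1 h2 rfl)

lemma iso_eps {n l k i : ℕ} (hn : 2 ≤ n) (hi : i ≤ n) {ι : Tup n × Tup n → Tup n × Tup n}
    (hι : IsIsoA n l k ι) (N : ℕ) : ∀ u ∈ BA n l ×ˢ BA n k, epsT n i u = N →
    epsT n i (ι u) = N := by
  induction N with
  | zero =>
    intro u hu h
    rw [← eTen_none hn hi] at h ⊢
    have := (hι.2 u hu i hi).1
    rw [h] at this
    exact this.symm
  | succ N ih =>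
    intro u hu h
    have h0 : eTenA n i u ≠ none := by rw [Ne, eTen_none hn hi]; omega
    obtain ⟨v, hv⟩ := Option.ne_none_iff_exists'.1 h0
    have h1 := eTen_eps hn hi hv
    have h2 := ih v (eTen_mem hn hi hv hu) (by omega)
    have := (hι.2 u hu i hi).1
    rw [hv] at this
    have := eTen_eps hn hi this.symm
    omega

lemma topT_mem {n l k : ℕ} (hn : 2 ≤ n) : topT n l k ∈ BA n l ×ˢ BA n k := by
  constructor
  · show tsum (tripleVec n l 0 0) = l
    rw [tsum_triple hn]; omega
  · show tsum (tripleVec n _ 0 _) = k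
    rw [tsum_triple hn]; omega

lemma iso_top {n l k : ℕ} (hn : 2 ≤ n) {ι : Tup n × Tup n → Tup n × Tup n}
    (hι : IsIsoA n l k ι) : ι (topT n l k) = topT n k l := by
  have hm := topT_mem (l := l) (k := k) hn
  have hm' := hι.1.mapsTo hm
  obtain ⟨a, c, d, h1, h2, h3⟩ := highest_shape hn hm' (fun i h1 h2 => by
    apply iso_eps hn h2 hι _ _ hm
    simp only [topT, epsT, eps_triple hn h2, phi_triple hn h2]
    split_ifs <;> omega)
  have h4 := iso_eps hn (Nat.zero_le n) hι _ _ hm rfl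
  rw [h3] at h4
  simp only [topT, epsT, eps_triple hn (Nat.zero_le n), phi_triple hn (Nat.zero_le n),
    if_true] at h4
  have h5 := (hι.2 _ hm 2 hn).2
  have h6 : fTenA n 2 (topT n l k) = none := by
    unfold fTenA
    rw [epsA_eq hn hn, phiA_eq hn hn, if_neg]
    · simp only [topT, Option.map_eq_none_iff]
      rw [fA_none hn hn, phi_triple hn hn]; simp
    · simp [topT, phi_triple hn hn]
  rw [h6, h3] at h5
  unfold fTenA at h5
  rw [epsA_eq hn hn, phiA_eq hn hn, if_neg (by simp [phi_triple hn hn])] at h5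
  have h7 := h5.symm
  simp only [Option.map_none, Option.map_eq_none_iff] at h7
  rw [fA_none hn hn, phi_triple hn hn] at h7
  simp at h7
  subst h7
  rw [h3]
  unfold topT
  have e1 : d = min k l := by omega
  have e2 : a = l - min k l := by omega
  rw [← e1, ← show a = l - d by omega]

lemma Phi_top {n l k : ℕ} (hl : 1 ≤ l) (hk : 1 ≤ k) :
    Phi (topT n (l-1) (k-1)) = topT n l k := by
  unfold Phi topT
  simp only [acute_triple, grave_triple]
  have e1 : l - 1 + 1 = l := by omega
  have e2 : min (l-1) (k-1) + 1 = min l k := by omega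
  have e3 : k - 1 - min (l-1) (k-1) = k - min l k := by omega
  rw [e1, e2, e3]

lemma Phi_mem {n l k : ℕ} (hn : 2 ≤ n) (hl : 1 ≤ l) (hk : 1 ≤ k) {u : Tup n × Tup n}
    (hu : u ∈ BA n (l-1) ×ˢ BA n (k-1)) : Phi u ∈ BA n l ×ˢ BA n k := by
  obtain ⟨m1, m2⟩ := hu
  change tsum u.1 = l - 1 at m1
  change tsum u.2 = k - 1 at m2
  constructor
  · show tsum (acuteA u.1) = l
    rw [tsum_acute hn]; omega
  · show tsum (graveA u.2) = k
    rw [tsum_grave hn]; omega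

lemma iso_Phi {n l k : ℕ} (hn : 2 ≤ n) (hl : 1 ≤ l) (hk : 1 ≤ k)
    {ι ι' : Tup n × Tup n → Tup n × Tup n} (hι : IsIsoA n l k ι)
    (hι' : IsIsoA n (l-1) (k-1) ι') (u : Tup n × Tup n) (hu : u ∈ BA n (l-1) ×ˢ BA n (k-1)) :
    ι (Phi u) = Phi (ι' u) := by
  have hr := reach_top hn hu
  revert hu
  induction hr using Relation.ReflTransGen.head_induction_on with
  | refl =>
    intro _
    rw [Phi_top hl hk, iso_top hn hι, iso_top hn hι', Phi_top hk hl]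
  | head hs _ ih =>
    rename_i u v
    intro hu
    obtain ⟨i, hi, hv⟩ := hs
    have hvm := eTen_mem hn hi hv hu
    have hf := fTen_of_eTen hn hi hv
    have h1 := (hι.2 _ (Phi_mem hn hl hk hvm) i hi).2
    rw [fTen_Phi hn hi hf, ih hvm] at h1
    have h2 := (hι'.2 _ hvm i hi).2
    rw [hf] at h2
    rw [fTen_Phi hn hi h2.symm] at h1
    simpa using h1

lemma energy_step {n l k : ℕ} (hn : 2 ≤ n) (hl : 1 ≤ l) (hk : 1 ≤ k)
    {ι ι' : Tup n × Tup n → Tup n × Tup n} (hι : IsIsoA n l k ι)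
    (hι' : IsIsoA n (l-1) (k-1) ι') {H H' : Tup n × Tup n → ℤ} (hH : IsEnergyA n l k ι H)
    (hH' : IsEnergyA n (l - 1) (k - 1) ι' H') {u v : Tup n × Tup n}
    (hu : u ∈ BA n (l-1) ×ˢ BA n (k-1)) (hs : StepE n u v) :
    H (Phi v) - H' v = H (Phi u) - H' u := by
  obtain ⟨i, hi, hv⟩ := hs
  have h1 := hH.1 _ (Phi_mem hn hl hk hu) i hi _ (eTen_Phi hn hi hv)
  have h2 := hH'.1 _ hu i hi _ hv
  rw [iso_Phi hn hl hk hι hι' u hu] at h1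
  have h0 : 0 ≤ n := Nat.zero_le n
  simp only [Phi, epsA_eq hn h0, phiA_eq hn h0, phi_acute hn h0, eps_grave hn h0, zero_ne_one,
    if_false, add_zero] at h1 h2 ⊢
  rw [h1, h2]
  ring

lemma energy_top {n l k : ℕ} (hn : 2 ≤ n) (hl : 1 ≤ l) (hk : 1 ≤ k)
    {ι ι' : Tup n × Tup n → Tup n × Tup n} (hι : IsIsoA n l k ι)
    (hι' : IsIsoA n (l-1) (k-1) ι') {H H' : Tup n × Tup n → ℤ} (hH : IsEnergyA n l k ι H)
    (hH' : IsEnergyA n (l - 1) (k - 1) ι' H') (u : Tup n × Tup n)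
    (hu : u ∈ BA n (l-1) ×ˢ BA n (k-1)) :
    H (Phi u) - H' u = H (Phi (topT n (l-1) (k-1))) - H' (topT n (l-1) (k-1)) := by
  have hr := reach_top hn hu
  revert hu
  induction hr using Relation.ReflTransGen.head_induction_on with
  | refl => intro _; rfl
  | head hs _ ih =>
    intro hu
    rw [← energy_step hn hl hk hι hι' hH hH' hu hs]
    obtain ⟨i, hi, hv⟩ := hs
    exact ih (eTen_mem hn hi hv hu)

/-- **Reduction for `A_{2n-1}^{(2)}`** (Remark at the end of Section 5).  The combinatorial
`R` on `B_l ⊗ B_k` restricted along `ά^l_{l-1} ⊗ ὰ^k_{k-1}` agrees with the combinatorial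
`R` on `B_{l-1} ⊗ B_{k-1}`, and the energies agree. -/
theorem reduction_A
    (n l k : ℕ) (hn : 2 ≤ n) (hl : 2 ≤ l) (hk : 2 ≤ k)
    (ι : Tup n × Tup n → Tup n × Tup n) (hι : IsIsoA n l k ι)
    (ι' : Tup n × Tup n → Tup n × Tup n) (hι' : IsIsoA n (l - 1) (k - 1) ι')
    (H : Tup n × Tup n → ℤ) (hH : IsEnergyA n l k ι H)
    (H' : Tup n × Tup n → ℤ) (hH' : IsEnergyA n (l - 1) (k - 1) ι' H')
    (c1 c2 : Tup n) (hc1 : c1 ∈ BA n (l - 1)) (hc2 : c2 ∈ BA n (k - 1))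
    (c2' c1' : Tup n) (hval : ι' (c1, c2) = (c2', c1')) :
    ι (acuteA c1, graveA c2) = (acuteA c2', graveA c1') ∧
    H (acuteA c1, graveA c2) = H' (c1, c2) := by
  have hl1 : 1 ≤ l := by omega
  have hk1 : 1 ≤ k := by omega
  have hu : (c1, c2) ∈ BA n (l-1) ×ˢ BA n (k-1) := ⟨hc1, hc2⟩
  constructor
  · have := iso_Phi hn hl1 hk1 hι hι' (c1, c2) hu
    rw [hval] at this
    exact this
  · have hu0 : (uvec n (l-1), barvec n (k-1)) ∈ BA n (l-1) ×ˢ BA n (k-1) := by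
      constructor
      · show tsum (uvec n (l-1)) = l - 1
        rw [uvec_eq, tsum_triple hn]; rfl
      · show tsum (barvec n (k-1)) = k - 1
        rw [barvec_eq, tsum_triple hn]; omega
    have h1 := energy_top hn hl1 hk1 hι hι' hH hH' _ hu
    have h2 := energy_top hn hl1 hk1 hι hι' hH hH' _ hu0
    have h3 : Phi (uvec n (l-1), barvec n (k-1)) = (uvec n l, barvec n k) := by
      simp only [Phi, uvec_eq, barvec_eq, acute_triple, grave_triple]
      rw [Nat.sub_add_cancel hl1, Nat.sub_add_cancel hk1]
    rw [h3, hH.2, hH'.2] at h2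
    have h4 : H (Phi (c1, c2)) = H' (c1, c2) := by linarith
    exact h4

end KTT
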